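/- arXiv:2511.10422 — 2 statements merged into one kernel-verified Lean document; each statement's English description precedes it below -/
import Mathlib

section
/- Let q : ℝ and let r, s, t be nonzero integers. If the matrix M := (B q)^r * A^{-s} * (B q)^t in SL(2,ℝ) satisfies M 1 0 = 0, then the homomorphism φ_q : FreeGroup Bool →* SL(2,ℝ) is not injective; i.e. if q is a 1-step relation number then A and B q do not freely generate a free group. -/
abbrev SL2R := Matrix.SpecialLinearGroup (Fin 2) ℝ

/-- The matrix `A = [[1,1],[0,1]]` in `SL(2,ℝ)`. -/
def A : SL2R := ⟨!![1,1;0,1], by norm_num [Matrix.det_fin_two_of]⟩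

/-- The matrix `B q = [[1,0],[q,1]]` in `SL(2,ℝ)`. -/
def B (q : ℝ) : SL2R := ⟨!![1,0;q,1], by norm_num [Matrix.det_fin_two_of]⟩
/-- The homomorphism sending the generators of the free group on two
generators to `A` and `B q`. -/
def φ (q : ℝ) : FreeGroup Bool →* SL2R :=
  FreeGroup.lift (fun b : Bool => if b then B q else A)

theorem A_coe : (A : Matrix (Fin 2) (Fin 2) ℝ) = !![1, 1; 0, 1] := rfl

theorem B_coe (q : ℝ) : (B q : Matrix (Fin 2) (Fin 2) ℝ) = !![1, 0; q, 1] := rfl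

theorem A_zpow_coe (n : ℤ) :
    ((A ^ n : SL2R) : Matrix (Fin 2) (Fin 2) ℝ) = !![1, (n : ℝ); 0, 1] := by
  induction n using Int.induction_on with
  | zero => simp [Matrix.one_fin_two]
  | succ n ih =>
    rw [zpow_add_one, Matrix.SpecialLinearGroup.coe_mul, ih, A_coe]
    simp [add_comm]
  | pred n ih =>
    rw [zpow_sub_one, Matrix.SpecialLinearGroup.coe_mul, ih,
      Matrix.SpecialLinearGroup.coe_inv, A_coe, Matrix.adjugate_fin_two_of]
    simp
    ring

theorem B_zpow_coe (q : ℝ) (n : ℤ) :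
    ((B q ^ n : SL2R) : Matrix (Fin 2) (Fin 2) ℝ) = !![1, 0; n * q, 1] := by
  induction n using Int.induction_on with
  | zero => simp [Matrix.one_fin_two]
  | succ n ih =>
    rw [zpow_add_one, Matrix.SpecialLinearGroup.coe_mul, ih, B_coe]
    simp [add_mul]
  | pred n ih =>
    rw [zpow_sub_one, Matrix.SpecialLinearGroup.coe_mul, ih,
      Matrix.SpecialLinearGroup.coe_inv, B_coe, Matrix.adjugate_fin_two_of]
    simp
    ring

theorem one_step_apply_one_zero (q : ℝ) (r s t : ℤ) :
    ((B q) ^ r * A ^ (-s) * (B q) ^ t) 1 0 = q * (r + t - r * s * t * q) := by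
  rw [Matrix.SpecialLinearGroup.coe_mul, Matrix.SpecialLinearGroup.coe_mul,
    A_zpow_coe, B_zpow_coe, B_zpow_coe]
  simp
  ring

/-- `A` commutes with its conjugate by `M` exactly when `M` is upper triangular. -/
theorem commute_A_conj_iff (M : SL2R) : Commute A (M * A * M⁻¹) ↔ M 1 0 = 0 := by
  have hdet := M.det_coe
  rw [Matrix.det_fin_two] at hdet
  have hM : ((M * A * M⁻¹ : SL2R) : Matrix (Fin 2) (Fin 2) ℝ) =
      !![1 - M 0 0 * M 1 0, M 0 0 ^ 2; -M 1 0 ^ 2, 1 + M 0 0 * M 1 0] := by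
    rw [Matrix.SpecialLinearGroup.coe_mul, Matrix.SpecialLinearGroup.coe_mul,
      Matrix.SpecialLinearGroup.coe_inv, A_coe, Matrix.adjugate_fin_two]
    ext i j
    fin_cases i <;> fin_cases j <;>
      simp [Matrix.mul_apply, Fin.sum_univ_two] <;>
      grind
  rw [commute_iff_eq, Matrix.SpecialLinearGroup.ext_iff, Matrix.ext_iff,
    Matrix.SpecialLinearGroup.coe_mul, Matrix.SpecialLinearGroup.coe_mul _ A, hM, A_coe]
  constructor
  · intro h
    have h00 := congrFun (congrFun h 0) 0
    simpa using h00
  · intro h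
    simp [h, add_comm]

/-- If `q` is a 1-step relation number then `A` and `B q` do not freely generate
a free group. -/
theorem not_injective_of_one_step (q : ℝ) (r s t : ℤ)
    (hr : r ≠ 0) (hs : s ≠ 0) (ht : t ≠ 0)
    (h : ((B q) ^ r * A ^ (-s) * (B q) ^ t) 1 0 = 0) :
    ¬ Function.Injective (φ q) := by
  intro hinj
  let a : FreeGroup Bool := FreeGroup.of false
  let b : FreeGroup Bool := FreeGroup.of true
  let w : FreeGroup Bool := b ^ r * a ^ (-s) * b ^ t
  have ha (p : ℝ) : φ p a = A := by simp [φ, a]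
  have hw (p : ℝ) : φ p w = B p ^ r * A ^ (-s) * B p ^ t := by simp [φ, w, a, b]
  have hcomm : Commute a (w * a * w⁻¹) := by
    refine Commute.of_map hinj ?_
    rw [map_mul, map_mul, map_inv, ha, commute_A_conj_iff, hw]
    exact h
  -- The same relation then holds for every parameter, in particular for a generic one.
  have hall (p : ℝ) : p * (r + t - r * s * t * p) = 0 := by
    have hp := hcomm.map (φ p)
    rwa [map_mul, map_mul, map_inv, ha, commute_A_conj_iff, hw, one_step_apply_one_zero] at hp
  have hrst : (r * s * t : ℝ) ≠ 0 := by
    exact_mod_cast mul_ne_zero (mul_ne_zero hr hs) ht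
  have hp := hall (((r + t : ℝ) ^ 2 + 1) / (r * s * t))
  rw [mul_div_cancel₀ _ hrst] at hp
  rcases mul_eq_zero.mp hp with hp | hp
  · exact div_ne_zero (by positivity) hrst hp
  · nlinarith [sq_nonneg ((r + t : ℝ) - 1), sq_nonneg (r + t : ℝ)]
end

section
/- There exists a sequence q : ℕ → ℚ such that (i) the real sequence (q n : ℝ) tends to 1 + Real.sqrt 2 as n → ∞; (ii) (q n : ℝ) ≠ 1 + Real.sqrt 2 for all n (so the sequence is non-constant); and (iii) for every n there exists a nonzero integer x such that, writing qₙ := (q n : ℝ), the matrix M := A * (B qₙ)^x * A * (B qₙ)⁻¹ * A * (B qₙ)⁻¹ in SL(2,ℝ) satisfies M 0 0 = M 1 1. In particular, 1 + √2 is an accumulation point of rational length-6 half-relation numbers. -/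
/-- The Pell equation `s² - 2r² = 1` has solutions with `r` arbitrarily large. -/
theorem exists_pell_solution_gt (n : ℕ) :
    ∃ s r : ℤ, (n : ℤ) < r ∧ r < s ∧ s ^ 2 - 2 * r ^ 2 = 1 := by
  induction n with
  | zero => exact ⟨3, 2, by norm_num⟩
  | succ k ih =>
    obtain ⟨s, r, hk, hrs, h⟩ := ih
    refine ⟨3 * s + 4 * r, 2 * s + 3 * r, ?_, ?_, ?_⟩
    · push_cast; linarith
    · linarith
    · linear_combination h

theorem coe_B_zpow (q : ℝ) (x : ℤ) :
    ((B q ^ x : SL2R) : Matrix (Fin 2) (Fin 2) ℝ) = !![1, 0; x * q, 1] := by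
  induction x using Int.induction_on with
  | zero => simp [Matrix.one_fin_two]
  | succ k ih =>
    rw [zpow_add_one, Matrix.SpecialLinearGroup.coe_mul, ih]
    simp [B]
    ring
  | pred k ih =>
    rw [zpow_sub_one, Matrix.SpecialLinearGroup.coe_mul, ih, Matrix.SpecialLinearGroup.coe_inv]
    simp [B, Matrix.adjugate_fin_two]
    ring

/-- The diagonal entries of `A Bˣ A B⁻¹ A B⁻¹` agree when
`2(q - 2) + x (q² - 2q - 1)` vanishes. -/
theorem half_relation_of_eq_zero {q : ℝ} {x : ℤ}
    (h : 2 * (q - 2) + x * (q ^ 2 - 2 * q - 1) = 0) :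
    (A * B q ^ x * A * (B q)⁻¹ * A * (B q)⁻¹) 0 0
      = (A * B q ^ x * A * (B q)⁻¹ * A * (B q)⁻¹) 1 1 := by
  rw [← zpow_neg_one]
  simp only [Matrix.SpecialLinearGroup.coe_mul, coe_B_zpow]
  simp [A]
  linear_combination q * h

/-- `1 + √2` is an accumulation point of rational length-6 half-relation numbers. -/
theorem accumulation_at_one_add_sqrt_two :
    ∃ q : ℕ → ℚ,
      Filter.Tendsto (fun n => (q n : ℝ)) Filter.atTop (nhds (1 + Real.sqrt 2)) ∧
      (∀ n, (q n : ℝ) ≠ 1 + Real.sqrt 2) ∧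
      (∀ n, ∃ x : ℤ, x ≠ 0 ∧
        (A * (B (q n : ℝ)) ^ x * A * (B (q n : ℝ))⁻¹ * A * (B (q n : ℝ))⁻¹) 0 0
          = (A * (B (q n : ℝ)) ^ x * A * (B (q n : ℝ))⁻¹ * A * (B (q n : ℝ))⁻¹) 1 1) := by
  choose s r hn hrs hpell using exists_pell_solution_gt
  have hr (n : ℕ) : 0 < r n := by have := hn n; omega
  have hrR (n : ℕ) : (0 : ℝ) < r n := by exact_mod_cast hr n
  have hpellR (n : ℕ) : (s n : ℝ) ^ 2 - 2 * (r n : ℝ) ^ 2 = 1 := by exact_mod_cast hpell n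
  refine ⟨fun n => 1 + s n / r n, ?_, fun n h => ?_, fun n => ⟨-2 * r n * (s n - r n), ?_, ?_⟩⟩
  · have heq (n : ℕ) : (s n / r n : ℝ) = √(2 + ((r n : ℝ)⁻¹) ^ 2) := by
      have hs : (0 : ℝ) < s n := by exact_mod_cast (hr n).trans (hrs n)
      have := hrR n
      rw [eq_comm, Real.sqrt_eq_iff_eq_sq (by positivity) (by positivity)]
      field_simp
      linear_combination -hpellR n
    have hlim : Filter.Tendsto (fun n => (r n : ℝ)) Filter.atTop Filter.atTop :=
      Filter.tendsto_atTop_mono (fun n => by exact_mod_cast (hn n).le)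
        tendsto_natCast_atTop_atTop
    have hsqrt := (((tendsto_inv_atTop_zero.comp hlim).pow 2).const_add 2).sqrt.const_add 1
    simpa [heq] using hsqrt
  · refine irrational_sqrt_two ⟨s n / r n, ?_⟩
    push_cast at h ⊢
    linarith
  · have := hr n
    have := hrs n
    exact mul_ne_zero (mul_ne_zero (by norm_num) (by omega)) (by omega)
  · apply half_relation_of_eq_zero
    have := (hrR n).ne'
    push_cast
    field_simp
    linear_combination (-2 * (s n - r n : ℝ)) * hpellR n
end
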